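/- arXiv:2112.12084 — 4 statements merged into one kernel-verified Lean document; each statement's English description precedes it below -/
import Mathlib

section
/- Let α ∈ (0, 1/2) and p ∈ (0, 1). Then the map k ↦ Q(α; p·k, k − p·k + 1) is nondecreasing on (0, ∞); that is, with the empirical success fraction held fixed at p, the one-sided Clopper–Pearson lower confidence bound increases with the sample size. -/
open Set Filter

/-- The (unnormalized) Beta function `Beta(a,b) = ∫₀¹ t^(a−1)(1−t)^(b−1) dt`. -/
noncomputable def betaFn (a b : ℝ) : ℝ :=
  ∫ t in (0:ℝ)..1, t ^ (a - 1) * (1 - t) ^ (b - 1)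

/-- The regularized incomplete Beta function `I_x(a,b)`. -/
noncomputable def regBeta (x a b : ℝ) : ℝ :=
  (∫ t in (0:ℝ)..x, t ^ (a - 1) * (1 - t) ^ (b - 1)) / betaFn a b

/-- The Beta quantile `Q(α; a, b)`: the unique `x ∈ (0,1)` with `I_x(a,b) = α`
(realized as the infimum of the solution set, which is a singleton when the
quantile is well-defined). -/
noncomputable def betaQuantile (α a b : ℝ) : ℝ :=
  sInf {x : ℝ | x ∈ Set.Ioo (0:ℝ) 1 ∧ regBeta x a b = α}

/-- The standard Gaussian CDF `Φ`. -/
noncomputable def stdGaussCDF (t : ℝ) : ℝ :=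
  ∫ s in Set.Iic t, (Real.sqrt (2 * Real.pi))⁻¹ * Real.exp (-(s ^ 2) / 2)

/-- The inverse `Φ⁻¹` of the standard Gaussian CDF. -/
noncomputable def stdGaussCDFInv : ℝ → ℝ := Function.invFun stdGaussCDF

/-- The absolute decline `AD(k; k̄, p)`. -/
noncomputable def absDecline (α σ kbar k p : ℝ) : ℝ :=
  σ * stdGaussCDFInv (betaQuantile α (p * kbar) (kbar - p * kbar + 1)) -
    σ * stdGaussCDFInv (betaQuantile α (p * k) (k - p * k + 1))

/-- The input-specific sample size `ψ_AD(p)` for the absolute-decline criterion. -/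
noncomputable def psiAD (α σ kbar U p : ℝ) : ℝ :=
  sInf {k : ℝ | k ∈ Set.Ioc (0:ℝ) kbar ∧ absDecline α σ kbar k p ≤ U}

/-- The relative decline `RD(k; k̄, p)`. -/
noncomputable def relDecline (α σ kbar k p : ℝ) : ℝ :=
  absDecline α σ kbar k p /
    (σ * stdGaussCDFInv (betaQuantile α (p * kbar) (kbar - p * kbar + 1)))

/-- The input-specific sample size `ψ_RD(p)` for the relative-decline criterion. -/
noncomputable def psiRD (α σ kbar U p : ℝ) : ℝ :=
  sInf {k : ℝ | k ∈ Set.Ioc (0:ℝ) kbar ∧ relDecline α σ kbar k p ≤ U}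

open Classical in
/-- The piecewise-constant approximation `ψ_ISS` of `ψ_AD` on a grid of width `δ`. -/
noncomputable def psiISS (α σ kbar U δ p : ℝ) : ℝ :=
  if ∃ N : ℕ, p = (N : ℝ) * δ then psiAD α σ kbar U p
  else max (psiAD α σ kbar U ((⌊p / δ⌋ : ℝ) * δ)) (psiAD α σ kbar U ((⌈p / δ⌉ : ℝ) * δ))

/-- For `p ∈ (0,1)` and `r > 0`, the solution `u < p` of the level equation
`p log u + (1-p) log (1-u) = p log v + (1-p) log (1-v)` with `v = u * exp ((1-p) r)`. -/
noncomputable def levelParam (p r : ℝ) : ℝ := (Real.exp (p * r) - 1) / (Real.exp r - 1)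

/-- The logarithmic derivative of `levelParam p`. -/
noncomputable def levelParamLogDeriv (p r : ℝ) : ℝ :=
  p * Real.exp (p * r) / (Real.exp (p * r) - 1) - Real.exp r / (Real.exp r - 1)

/-- The logarithm of `t ^ p * (1 - t) ^ (1 - p)`. -/
noncomputable def binomialLogLik (p t : ℝ) : ℝ := p * Real.log t + (1 - p) * Real.log (1 - t)

/-- The unnormalized density of the Beta distribution with parameters `p k` and `(1-p) k + 1`. -/
noncomputable def clopperPearsonDensity (p k t : ℝ) : ℝ :=
  t ^ (p * k - 1) * (1 - t) ^ (k - p * k + 1 - 1)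

section LevelParam

variable {p r : ℝ}

theorem one_lt_exp_mul (hp : 0 < p) (hr : 0 < r) : 1 < Real.exp (p * r) :=
  Real.one_lt_exp_iff.2 (mul_pos hp hr)

theorem levelParam_pos (hp : 0 < p) (hr : 0 < r) : 0 < levelParam p r :=
  div_pos (sub_pos.2 (one_lt_exp_mul hp hr)) (sub_pos.2 (Real.one_lt_exp_iff.2 hr))

theorem levelParam_le_exp (hp1 : p < 1) (hr : 0 < r) :
    levelParam p r ≤ Real.exp (-((1 - p) * r)) := by
  have hb : 1 < Real.exp r := Real.one_lt_exp_iff.2 hr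
  have h : Real.exp (p * r) = Real.exp (-((1 - p) * r)) * Real.exp r := by
    rw [← Real.exp_add]; ring_nf
  have h1 : Real.exp (-((1 - p) * r)) ≤ 1 := by
    rw [Real.exp_le_one_iff]; nlinarith
  rw [levelParam, div_le_iff₀ (by linarith), h]
  nlinarith

theorem levelParam_one_sub (hr : 0 < r) :
    1 - levelParam p r * Real.exp ((1 - p) * r) = levelParam (1 - p) r := by
  have hb : Real.exp r - 1 ≠ 0 := (sub_pos.2 (Real.one_lt_exp_iff.2 hr)).ne'
  have h : Real.exp r = Real.exp (p * r) * Real.exp ((1 - p) * r) := by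
    rw [← Real.exp_add]; ring_nf
  unfold levelParam
  generalize Real.exp (p * r) = a at h ⊢
  generalize Real.exp ((1 - p) * r) = b at h ⊢
  field_simp
  linear_combination h

theorem one_sub_levelParam (hr : 0 < r) :
    1 - levelParam p r = levelParam (1 - p) r * Real.exp (p * r) := by
  have h := levelParam_one_sub (p := 1 - p) hr
  rw [sub_sub_cancel] at h
  linarith

theorem levelParam_lt_one (hp1 : p < 1) (hr : 0 < r) : levelParam p r < 1 := by
  have h := one_sub_levelParam (p := p) hr
  have := mul_pos (levelParam_pos (sub_pos.2 hp1) hr) (Real.exp_pos (p * r))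
  linarith

theorem levelParam_mul_exp_lt_one (hp1 : p < 1) (hr : 0 < r) :
    levelParam p r * Real.exp ((1 - p) * r) < 1 := by
  have h := levelParam_one_sub (p := p) hr
  have := levelParam_pos (sub_pos.2 hp1) hr
  linarith

theorem levelParam_lt_mul_exp (hp : 0 < p) (hp1 : p < 1) (hr : 0 < r) :
    levelParam p r < levelParam p r * Real.exp ((1 - p) * r) :=
  lt_mul_of_one_lt_right (levelParam_pos hp hr) (one_lt_exp_mul (sub_pos.2 hp1) hr)

theorem binomialLogLik_levelParam (hp : 0 < p) (hp1 : p < 1) (hr : 0 < r) :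
    binomialLogLik p (levelParam p r * Real.exp ((1 - p) * r)) =
      binomialLogLik p (levelParam p r) := by
  unfold binomialLogLik
  rw [levelParam_one_sub hr, one_sub_levelParam hr,
    Real.log_mul (levelParam_pos hp hr).ne' (Real.exp_pos _).ne',
    Real.log_mul (levelParam_pos (sub_pos.2 hp1) hr).ne' (Real.exp_pos _).ne',
    Real.log_exp, Real.log_exp]
  ring

theorem hasDerivAt_levelParam (hp : 0 < p) (hr : 0 < r) :
    HasDerivAt (levelParam p) (levelParam p r * levelParamLogDeriv p r) r := by
  have hb : Real.exp r - 1 ≠ 0 := (sub_pos.2 (Real.one_lt_exp_iff.2 hr)).ne'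
  have ha : Real.exp (p * r) - 1 ≠ 0 := (sub_pos.2 (one_lt_exp_mul hp hr)).ne'
  have h1 : HasDerivAt (fun s => Real.exp (p * s) - 1) (Real.exp (p * r) * (p * 1)) r :=
    (((hasDerivAt_id r).const_mul p).exp).sub_const 1
  have h2 : HasDerivAt (fun s => Real.exp s - 1) (Real.exp r) r :=
    (Real.hasDerivAt_exp r).sub_const 1
  refine (h1.div h2 hb).congr_deriv ?_
  unfold levelParam levelParamLogDeriv
  field_simp

theorem hasDerivAt_levelParam_mul_exp (hp : 0 < p) (hr : 0 < r) :
    HasDerivAt (fun s => levelParam p s * Real.exp ((1 - p) * s))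
      (levelParam p r * Real.exp ((1 - p) * r) * (levelParamLogDeriv p r + (1 - p))) r := by
  have h1 : HasDerivAt (fun s => Real.exp ((1 - p) * s))
      (Real.exp ((1 - p) * r) * ((1 - p) * 1)) r := ((hasDerivAt_id r).const_mul (1 - p)).exp
  refine ((hasDerivAt_levelParam hp hr).mul h1).congr_deriv ?_
  ring

/-- Equivalent to `p * coth (p r / 2) ≤ coth (r / 2)`. -/
theorem mul_exp_add_one_mul_le (hp : 0 < p) (hp1 : p < 1) (hr : 0 < r) :
    p * (Real.exp (p * r) + 1) * (Real.exp r - 1) ≤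
      (Real.exp r + 1) * (Real.exp (p * r) - 1) := by
  let K : ℝ → ℝ := fun s => (Real.exp s + 1) * (Real.exp (p * s) - 1) -
    p * (Real.exp (p * s) + 1) * (Real.exp s - 1)
  have hK : ∀ s, HasDerivAt K ((1 + p) *
      ((1 - p) * Real.exp (p * s) * Real.exp s + p * Real.exp (p * s) - Real.exp s)) s := by
    intro s
    have h1 : HasDerivAt (fun s => Real.exp (p * s)) (Real.exp (p * s) * (p * 1)) s :=
      ((hasDerivAt_id s).const_mul p).exp
    have h2 := Real.hasDerivAt_exp s
    refine (((h2.add_const 1).mul (h1.sub_const 1)).sub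
      (((h1.add_const 1).const_mul p).mul (h2.sub_const 1))).congr_deriv ?_
    ring
  have hmono : Monotone K := by
    refine monotone_of_hasDerivAt_nonneg hK fun s => ?_
    have hconv := convexOn_exp.2 (mem_univ s) (mem_univ 0) (sub_nonneg.2 hp1.le) hp.le
      (by ring)
    simp only [smul_eq_mul, mul_zero, add_zero, Real.exp_zero, mul_one] at hconv
    have h : Real.exp s = Real.exp (p * s) * Real.exp ((1 - p) * s) := by
      rw [← Real.exp_add]; ring_nf
    have := mul_le_mul_of_nonneg_left hconv (Real.exp_pos (p * s)).le
    rw [← h] at this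
    refine mul_nonneg (by linarith) ?_
    linarith
  have h0 : K 0 ≤ K r := hmono hr.le
  simp only [K, mul_zero, Real.exp_zero, sub_self] at h0
  linarith

theorem levelParamLogDeriv_le (hp : 0 < p) (hp1 : p < 1) (hr : 0 < r) :
    2 * levelParamLogDeriv p r + (1 - p) ≤ 0 := by
  have hb : 0 < Real.exp r - 1 := sub_pos.2 (Real.one_lt_exp_iff.2 hr)
  have ha : 0 < Real.exp (p * r) - 1 := sub_pos.2 (one_lt_exp_mul hp hr)
  have h := mul_exp_add_one_mul_le hp hp1 hr
  have : 2 * levelParamLogDeriv p r + (1 - p) =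
      (p * (Real.exp (p * r) + 1) * (Real.exp r - 1) -
        (Real.exp r + 1) * (Real.exp (p * r) - 1)) /
        ((Real.exp (p * r) - 1) * (Real.exp r - 1)) := by
    unfold levelParamLogDeriv
    field_simp
    ring
  rw [this]
  exact div_nonpos_of_nonpos_of_nonneg (by linarith) (mul_pos ha hb).le

theorem tendsto_levelParam_atTop (hp : 0 < p) (hp1 : p < 1) :
    Tendsto (levelParam p) atTop (nhds 0) := by
  have h : Tendsto (fun r => Real.exp (-((1 - p) * r))) atTop (nhds 0) :=
    Real.tendsto_exp_neg_atTop_nhds_zero.comp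
      (tendsto_id.const_mul_atTop (sub_pos.2 hp1))
  refine tendsto_of_tendsto_of_tendsto_of_le_of_le' tendsto_const_nhds h ?_ ?_
  · filter_upwards [eventually_gt_atTop 0] with r hr using (levelParam_pos hp hr).le
  · filter_upwards [eventually_gt_atTop 0] with r hr using levelParam_le_exp hp1 hr

theorem tendsto_levelParam_zero (p : ℝ) :
    Tendsto (levelParam p) (nhdsWithin 0 (Ioi 0)) (nhds p) := by
  have hslope : ∀ c : ℝ, Tendsto (fun s => s⁻¹ * (Real.exp (c * s) - 1))
      (nhdsWithin 0 (Ioi 0)) (nhds c) := by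
    intro c
    have h1 : HasDerivAt (fun s => Real.exp (c * s)) (Real.exp (c * 0) * (c * 1)) 0 :=
      ((hasDerivAt_id (0 : ℝ)).const_mul c).exp
    have h2 := (hasDerivAt_iff_tendsto_slope_zero.1 h1).mono_left
      (nhdsWithin_mono 0 fun x (hx : x ∈ Ioi (0 : ℝ)) => hx.ne')
    simpa using h2
  have h := (hslope p).div (hslope 1) one_ne_zero
  rw [div_one] at h
  refine h.congr' ?_
  filter_upwards [self_mem_nhdsWithin] with s hs
  have hs' : s ≠ 0 := ne_of_gt hs
  simp only [Pi.div_apply, one_mul, levelParam]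
  exact mul_div_mul_left _ _ (inv_ne_zero hs')

theorem tendsto_levelParam_mul_exp_zero (p : ℝ) :
    Tendsto (fun r => levelParam p r * Real.exp ((1 - p) * r))
      (nhdsWithin 0 (Ioi 0)) (nhds p) := by
  have h : Tendsto (fun r => Real.exp ((1 - p) * r)) (nhdsWithin 0 (Ioi 0)) (nhds 1) := by
    have : ContinuousAt (fun r => Real.exp ((1 - p) * r)) 0 := by fun_prop
    simpa [ContinuousAt] using this.tendsto.mono_left nhdsWithin_le_nhds
  simpa using (tendsto_levelParam_zero p).mul h

theorem tendsto_levelParam_mul_exp_atTop (hp : 0 < p) (hp1 : p < 1) :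
    Tendsto (fun r => levelParam p r * Real.exp ((1 - p) * r)) atTop (nhds 1) := by
  have h := (tendsto_levelParam_atTop (sub_pos.2 hp1) (sub_lt_self 1 hp)).const_sub 1
  rw [sub_zero] at h
  refine h.congr' ?_
  filter_upwards [eventually_gt_atTop 0] with r hr
  rw [← levelParam_one_sub hr]
  ring

theorem exists_levelParam_eq (hp : 0 < p) (hp1 : p < 1) {x : ℝ} (hx : x ∈ Ioo 0 p) :
    ∃ r, 0 < r ∧ levelParam p r = x := by
  have hc : ContinuousOn (levelParam p) (Ioi 0) := fun r hr =>
    (hasDerivAt_levelParam hp hr).continuousAt.continuousWithinAt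
  exact isPreconnected_Ioi.intermediate_value_Ioo (l₁ := atTop)
    (l₂ := nhdsWithin 0 (Ioi 0)) (le_principal_iff.2 (Ioi_mem_atTop 0))
    (le_principal_iff.2 self_mem_nhdsWithin) hc (tendsto_levelParam_atTop hp hp1)
    (tendsto_levelParam_zero p) hx

/-- The mass of `h` to the left of `u` dominates its mass to the right of `v`, where
`u < p < v` lie on the same level of the binomial likelihood. -/
theorem integral_right_le_integral_left (hp : 0 < p) (hp1 : p < 1) {h : ℝ → ℝ}
    (hc : ContinuousOn h (Ioo 0 1)) (hi : IntervalIntegrable h MeasureTheory.volume 0 1)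
    (hr : 0 < r)
    (hnonneg : ∀ s, r ≤ s → 0 ≤ h (levelParam p s))
    (hlevel : ∀ s, r ≤ s → levelParam p s * h (levelParam p s) =
      levelParam p s * Real.exp ((1 - p) * s) * h (levelParam p s * Real.exp ((1 - p) * s))) :
    ∫ t in (levelParam p r * Real.exp ((1 - p) * r))..1, h t ≤
      ∫ t in (0 : ℝ)..levelParam p r, h t := by
  let u := levelParam p
  let v : ℝ → ℝ := fun s => levelParam p s * Real.exp ((1 - p) * s)
  let H : ℝ → ℝ := fun s => (∫ t in (0 : ℝ)..u s, h t) - ∫ t in (v s)..1, h t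
  have hu : ∀ s, 0 < s → u s ∈ Ioo (0 : ℝ) 1 := fun s hs =>
    ⟨levelParam_pos hp hs, levelParam_lt_one hp1 hs⟩
  have hv : ∀ s, 0 < s → v s ∈ Ioo (0 : ℝ) 1 := fun s hs =>
    ⟨mul_pos (levelParam_pos hp hs) (Real.exp_pos _), levelParam_mul_exp_lt_one hp1 hs⟩
  have hsub : ∀ a ∈ Icc (0 : ℝ) 1, ∀ b ∈ Icc (0 : ℝ) 1,
      IntervalIntegrable h MeasureTheory.volume a b := fun a ha b hb =>
    hi.mono_set (by rw [uIcc_of_le (zero_le_one' ℝ)]; exact uIcc_subset_Icc ha hb)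
  have hderiv : ∀ s, 0 < s → HasDerivAt H
      (h (u s) * (u s * levelParamLogDeriv p s) -
        -h (v s) * (v s * (levelParamLogDeriv p s + (1 - p)))) s := by
    intro s hs
    have hmeas := fun a (ha : a ∈ Ioo (0 : ℝ) 1) =>
      hc.stronglyMeasurableAtFilter isOpen_Ioo a ha (μ := MeasureTheory.volume)
    have hcont := fun a (ha : a ∈ Ioo (0 : ℝ) 1) => hc.continuousAt (isOpen_Ioo.mem_nhds ha)
    have h1 := (intervalIntegral.integral_hasDerivAt_right
      (hsub 0 (by simp) (u s) (Ioo_subset_Icc_self (hu s hs))) (hmeas _ (hu s hs))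
      (hcont _ (hu s hs))).comp s (hasDerivAt_levelParam hp hs)
    have h2 := (intervalIntegral.integral_hasDerivAt_left
      (hsub (v s) (Ioo_subset_Icc_self (hv s hs)) 1 (by simp)) (hmeas _ (hv s hs))
      (hcont _ (hv s hs))).comp s (hasDerivAt_levelParam_mul_exp hp hs)
    exact h1.sub h2
  have hanti : AntitoneOn H (Ici r) := by
    refine antitoneOn_of_deriv_nonpos (convex_Ici r)
      (fun s hs => (hderiv s (hr.trans_le hs)).continuousAt.continuousWithinAt)
      (fun s hs => ?_) (fun s hs => ?_)
    · rw [interior_Ici] at hs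
      exact (hderiv s (hr.trans hs)).differentiableAt.differentiableWithinAt
    · rw [interior_Ici] at hs
      have hs0 : 0 < s := hr.trans hs
      rw [(hderiv s hs0).deriv]
      have e : u s * h (u s) = v s * h (v s) := hlevel s (le_of_lt hs)
      have hn : 0 ≤ u s * h (u s) := mul_nonneg (hu s hs0).1.le (hnonneg s (le_of_lt hs))
      have := mul_nonpos_of_nonneg_of_nonpos hn (levelParamLogDeriv_le hp hp1 hs0)
      linear_combination this - (levelParamLogDeriv p s + (1 - p)) * e
  have hlim : Tendsto H atTop (nhds 0) := by
    have hcu : ContinuousOn (fun x => ∫ t in (0 : ℝ)..x, h t) (Icc 0 1) := by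
      have := intervalIntegral.continuousOn_primitive_interval' hi
        (left_mem_uIcc (a := (0 : ℝ)) (b := 1))
      rwa [uIcc_of_le (zero_le_one' ℝ)] at this
    have hmem : ∀ w : ℝ → ℝ, (∀ s, 0 < s → w s ∈ Ioo (0 : ℝ) 1) →
        ∀ᶠ s in atTop, w s ∈ Icc (0 : ℝ) 1 := fun w hw => by
      filter_upwards [eventually_gt_atTop 0] with s hs using Ioo_subset_Icc_self (hw s hs)
    have t1 := (hcu 0 (by simp)).tendsto.comp
      (tendsto_nhdsWithin_iff.2 ⟨tendsto_levelParam_atTop hp hp1, hmem u hu⟩)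
    have t2 := (hcu 1 (by simp)).tendsto.comp
      (tendsto_nhdsWithin_iff.2 ⟨tendsto_levelParam_mul_exp_atTop hp hp1, hmem v hv⟩)
    have t3 := t1.sub (t2.const_sub (∫ t in (0 : ℝ)..1, h t))
    simp only [intervalIntegral.integral_same, sub_self] at t3
    refine t3.congr' ?_
    filter_upwards [eventually_gt_atTop 0] with s hs
    simp only [Function.comp_apply, H]
    congr 1
    rw [sub_eq_iff_eq_add, add_comm]
    exact (intervalIntegral.integral_add_adjacent_intervals
      (hsub 0 (by simp) _ (Ioo_subset_Icc_self (hv s hs)))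
      (hsub _ (Ioo_subset_Icc_self (hv s hs)) 1 (by simp))).symm
  have hfin : 0 ≤ H r := le_of_tendsto hlim <| by
    filter_upwards [eventually_ge_atTop r] with s hs using hanti self_mem_Ici hs hs
  exact sub_nonneg.1 hfin

theorem strictConcaveOn_binomialLogLik (hp : 0 < p) (hp1 : p < 1) :
    StrictConcaveOn ℝ (Ioo 0 1) (binomialLogLik p) := by
  refine ⟨convex_Ioo 0 1, fun x hx y hy hxy a b ha hb hab => ?_⟩
  have h1 := strictConcaveOn_log_Ioi.2 (mem_Ioi.2 hx.1) (mem_Ioi.2 hy.1) hxy ha hb hab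
  have h2 := strictConcaveOn_log_Ioi.2 (mem_Ioi.2 (sub_pos.2 hx.2)) (mem_Ioi.2 (sub_pos.2 hy.2))
    (fun h => hxy (sub_right_injective h)) ha hb hab
  have e : a • (1 - x) + b • (1 - y) = 1 - (a • x + b • y) := by
    simp only [smul_eq_mul]; linear_combination hab
  rw [e] at h2
  simp only [binomialLogLik, smul_eq_mul] at h1 h2 ⊢
  have := mul_lt_mul_of_pos_left h1 hp
  have := mul_lt_mul_of_pos_left h2 (sub_pos.2 hp1)
  linarith

end LevelParam

section Density

variable {p k : ℝ}

theorem clopperPearsonDensity_eq {t : ℝ} (ht : t ∈ Ioo (0 : ℝ) 1) :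
    clopperPearsonDensity p k t = Real.exp (k * binomialLogLik p t) / t := by
  have h1 : 0 < 1 - t := sub_pos.2 ht.2
  rw [clopperPearsonDensity, Real.rpow_def_of_pos ht.1, Real.rpow_def_of_pos h1,
    ← Real.exp_add, eq_div_iff ht.1.ne']
  nth_rewrite 3 [← Real.exp_log ht.1]
  rw [← Real.exp_add, binomialLogLik]
  ring_nf

theorem clopperPearsonDensity_pos {t : ℝ} (ht : t ∈ Ioo (0 : ℝ) 1) :
    0 < clopperPearsonDensity p k t := by
  rw [clopperPearsonDensity_eq ht]
  exact div_pos (Real.exp_pos _) ht.1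

theorem continuousOn_clopperPearsonDensity :
    ContinuousOn (clopperPearsonDensity p k) (Ioo 0 1) := by
  refine ContinuousOn.mul (ContinuousOn.rpow_const continuousOn_id fun t ht => Or.inl ht.1.ne')
    (ContinuousOn.rpow_const (by fun_prop) fun t ht => Or.inl (sub_pos.2 ht.2).ne')

theorem intervalIntegrable_clopperPearsonDensity (hp : 0 < p) (hp1 : p < 1) (hk : 0 < k)
    (a b : ℝ) : IntervalIntegrable (clopperPearsonDensity p k) MeasureTheory.volume a b := by
  have hpk := mul_pos hp hk
  have hqk := mul_pos (sub_pos.2 hp1) hk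
  exact (intervalIntegral.intervalIntegrable_rpow' (by linarith)).mul_continuousOn
    (ContinuousOn.rpow_const (by fun_prop) fun t _ => Or.inr (by linarith))

theorem integral_clopperPearsonDensity_pos (hp : 0 < p) (hp1 : p < 1) (hk : 0 < k) {a b : ℝ}
    (ha : 0 ≤ a) (hab : a < b) (hb : b ≤ 1) : 0 < ∫ t in a..b, clopperPearsonDensity p k t :=
  intervalIntegral.intervalIntegral_pos_of_pos_on
    (intervalIntegrable_clopperPearsonDensity hp hp1 hk a b)
    (fun _ ht => clopperPearsonDensity_pos ⟨ha.trans_lt ht.1, ht.2.trans_le hb⟩) hab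

theorem regBeta_eq (x : ℝ) : regBeta x (p * k) (k - p * k + 1) =
    (∫ t in (0 : ℝ)..x, clopperPearsonDensity p k t) /
      ∫ t in (0 : ℝ)..1, clopperPearsonDensity p k t := rfl

theorem strictMonoOn_regBeta (hp : 0 < p) (hp1 : p < 1) (hk : 0 < k) :
    StrictMonoOn (fun x => regBeta x (p * k) (k - p * k + 1)) (Icc 0 1) := by
  intro x hx y hy hxy
  simp only [regBeta_eq]
  refine div_lt_div_of_pos_right ?_ (integral_clopperPearsonDensity_pos hp hp1 hk le_rfl
    zero_lt_one le_rfl)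
  rw [← intervalIntegral.integral_add_adjacent_intervals
    (intervalIntegrable_clopperPearsonDensity hp hp1 hk 0 x)
    (intervalIntegrable_clopperPearsonDensity hp hp1 hk x y)]
  linarith [integral_clopperPearsonDensity_pos hp hp1 hk hx.1 hxy hy.2]

theorem continuousOn_integral_clopperPearsonDensity (hp : 0 < p) (hp1 : p < 1) (hk : 0 < k) :
    ContinuousOn (fun x => ∫ t in (0 : ℝ)..x, clopperPearsonDensity p k t) (Icc 0 1) := by
  have := intervalIntegral.continuousOn_primitive_interval'
    (intervalIntegrable_clopperPearsonDensity hp hp1 hk 0 1)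
    (left_mem_uIcc (a := (0 : ℝ)) (b := 1))
  rwa [uIcc_of_le (zero_le_one' ℝ)] at this

theorem betaQuantile_spec (hp : 0 < p) (hp1 : p < 1) (hk : 0 < k) {α : ℝ}
    (hα : α ∈ Ioo (0 : ℝ) 1) :
    betaQuantile α (p * k) (k - p * k + 1) ∈ Ioo (0 : ℝ) 1 ∧
      regBeta (betaQuantile α (p * k) (k - p * k + 1)) (p * k) (k - p * k + 1) = α := by
  have hT := integral_clopperPearsonDensity_pos hp hp1 hk le_rfl zero_lt_one le_rfl
  have hc : ContinuousOn (fun x => regBeta x (p * k) (k - p * k + 1)) (Icc 0 1) := by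
    simp only [regBeta_eq]
    exact (continuousOn_integral_clopperPearsonDensity hp hp1 hk).div_const _
  obtain ⟨x, hx, hxα⟩ := intermediate_value_Ioo zero_le_one hc (by
    simpa [regBeta_eq, div_self hT.ne'] using hα)
  have hset : {x : ℝ | x ∈ Ioo (0 : ℝ) 1 ∧ regBeta x (p * k) (k - p * k + 1) = α} = {x} := by
    ext y
    refine ⟨fun hy => ?_, ?_⟩
    · exact (strictMonoOn_regBeta hp hp1 hk).injOn (Ioo_subset_Icc_self hy.1)
        (Ioo_subset_Icc_self hx) (hy.2.trans hxα.symm)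
    · rintro rfl
      exact ⟨hx, hxα⟩
  rw [betaQuantile, hset, csInf_singleton]
  exact ⟨hx, hxα⟩

theorem integral_clopperPearsonDensity_right_le_left (hp : 0 < p) (hp1 : p < 1) (hk : 0 < k) :
    ∫ t in p..1, clopperPearsonDensity p k t ≤ ∫ t in (0 : ℝ)..p, clopperPearsonDensity p k t := by
  have hc := continuousOn_integral_clopperPearsonDensity hp hp1 hk
  have hi := fun x : ℝ =>
    intervalIntegral.integral_add_adjacent_intervals
      (intervalIntegrable_clopperPearsonDensity hp hp1 hk 0 x)
      (intervalIntegrable_clopperPearsonDensity hp hp1 hk x 1)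
  have hcp := hc.continuousAt (Icc_mem_nhds hp hp1)
  have t1 := hcp.tendsto.comp (tendsto_levelParam_zero p)
  have t2 := hcp.tendsto.comp (tendsto_levelParam_mul_exp_zero p)
  have key := le_of_tendsto_of_tendsto
    (t2.const_sub (∫ t in (0 : ℝ)..1, clopperPearsonDensity p k t)) t1 (by
      filter_upwards [self_mem_nhdsWithin] with r hr
      have hr0 : 0 < r := hr
      have hu : ∀ s, r ≤ s → levelParam p s ∈ Ioo (0 : ℝ) 1 := fun s hs =>
        ⟨levelParam_pos hp (hr0.trans_le hs), levelParam_lt_one hp1 (hr0.trans_le hs)⟩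
      have hv : ∀ s, r ≤ s → levelParam p s * Real.exp ((1 - p) * s) ∈ Ioo (0 : ℝ) 1 :=
        fun s hs => ⟨mul_pos (hu s hs).1 (Real.exp_pos _),
          levelParam_mul_exp_lt_one hp1 (hr0.trans_le hs)⟩
      have h := integral_right_le_integral_left hp hp1 continuousOn_clopperPearsonDensity
        (intervalIntegrable_clopperPearsonDensity hp hp1 hk 0 1) hr0
        (fun s hs => (clopperPearsonDensity_pos (hu s hs)).le) (fun s hs => by
          rw [clopperPearsonDensity_eq (hu s hs), clopperPearsonDensity_eq (hv s hs),
            binomialLogLik_levelParam hp hp1 (hr0.trans_le hs),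
            mul_div_cancel₀ _ (hu s hs).1.ne', mul_div_cancel₀ _ (hv s hs).1.ne'])
      have e := hi (levelParam p r * Real.exp ((1 - p) * r))
      simp only [Function.comp_apply]
      linarith)
  have e := hi p
  linarith

theorem regBeta_le_of_le (hp : 0 < p) (hp1 : p < 1) (hk : 0 < k) {l : ℝ} (hkl : k ≤ l) {x : ℝ}
    (hx : x ∈ Ioo (0 : ℝ) 1) (hhalf : regBeta x (p * k) (k - p * k + 1) < 1 / 2) :
    regBeta x (p * l) (l - p * l + 1) ≤ regBeta x (p * k) (k - p * k + 1) := by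
  have hl : 0 < l := hk.trans_le hkl
  have hTk := integral_clopperPearsonDensity_pos hp hp1 hk le_rfl zero_lt_one le_rfl
  have hTl := integral_clopperPearsonDensity_pos hp hp1 hl le_rfl zero_lt_one le_rfl
  have hik := intervalIntegrable_clopperPearsonDensity hp hp1 hk
  have hil := intervalIntegrable_clopperPearsonDensity hp hp1 hl
  have hxp : x < p := by
    by_contra! hpx
    have h := (strictMonoOn_regBeta hp hp1 hk).monotoneOn ⟨hp.le, hp1.le⟩
      (Ioo_subset_Icc_self hx) hpx
    have h2 : 1 / 2 ≤ regBeta p (p * k) (k - p * k + 1) := by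
      rw [regBeta_eq, le_div_iff₀ hTk]
      have := intervalIntegral.integral_add_adjacent_intervals (hik 0 p) (hik p 1)
      linarith [integral_clopperPearsonDensity_right_le_left hp hp1 hk]
    exact (h2.trans h).not_gt hhalf
  obtain ⟨r, hr, hrx⟩ := exists_levelParam_eq hp hp1 ⟨hx.1, hxp⟩
  let y := levelParam p r * Real.exp ((1 - p) * r)
  have hxy : x < y := hrx ▸ levelParam_lt_mul_exp hp hp1 hr
  have hy : y ∈ Ioo (0 : ℝ) 1 := ⟨hx.1.trans hxy, levelParam_mul_exp_lt_one hp1 hr⟩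
  have hyx : binomialLogLik p y = binomialLogLik p x := hrx ▸ binomialLogLik_levelParam hp hp1 hr
  have hconc := strictConcaveOn_binomialLogLik hp hp1
  have hleft : ∀ t ∈ Ioc 0 x, binomialLogLik p t ≤ binomialLogLik p x := by
    intro t ht
    rcases ht.2.eq_or_lt with rfl | htx
    · exact le_rfl
    by_contra! hlt
    have := hconc.lt_on_openSegment ⟨ht.1, htx.trans hx.2⟩ hy (htx.trans hxy).ne
      (by rw [openSegment_eq_Ioo (htx.trans hxy)]; exact ⟨htx, hxy⟩)
    rw [hyx, min_eq_right hlt.le] at this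
    exact lt_irrefl _ this
  have hmid : ∀ t ∈ Ioo x y, binomialLogLik p x ≤ binomialLogLik p t := by
    intro t ht
    have := hconc.lt_on_openSegment hx hy hxy.ne (by rwa [openSegment_eq_Ioo hxy])
    rw [hyx, min_self] at this
    exact this.le
  let c := Real.exp ((l - k) * binomialLogLik p x)
  let h : ℝ → ℝ := fun t => c * clopperPearsonDensity p k t - clopperPearsonDensity p l t
  have hform : ∀ t ∈ Ioo (0 : ℝ) 1, h t = Real.exp (k * binomialLogLik p t) *
      (c - Real.exp ((l - k) * binomialLogLik p t)) / t := by
    intro t ht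
    have e : Real.exp (l * binomialLogLik p t) =
        Real.exp (k * binomialLogLik p t) * Real.exp ((l - k) * binomialLogLik p t) := by
      rw [← Real.exp_add]; ring_nf
    simp only [h]
    rw [clopperPearsonDensity_eq ht, clopperPearsonDensity_eq ht, e]
    ring
  have hh : ∀ a b : ℝ, IntervalIntegrable h MeasureTheory.volume a b := fun a b =>
    ((hik a b).const_mul c).sub (hil a b)
  have hint : ∀ a b : ℝ, ∫ t in a..b, h t =
      c * (∫ t in a..b, clopperPearsonDensity p k t) - ∫ t in a..b, clopperPearsonDensity p l t :=
    fun a b => by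
      rw [← intervalIntegral.integral_const_mul]
      exact intervalIntegral.integral_sub ((hik a b).const_mul c) (hil a b)
  have hnonneg : ∀ t ∈ Ioc 0 x, 0 ≤ h t := by
    intro t ht
    rw [hform t ⟨ht.1, ht.2.trans_lt hx.2⟩]
    refine div_nonneg (mul_nonneg (Real.exp_pos _).le (sub_nonneg.2 ?_)) ht.1.le
    exact Real.exp_le_exp.2 (mul_le_mul_of_nonneg_left (hleft t ht) (sub_nonneg.2 hkl))
  have hA : 0 ≤ ∫ t in (0 : ℝ)..x, h t := by
    have := intervalIntegral.integral_mono_on_of_le_Ioo hx.1.le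
      (IntervalIntegrable.zero (μ := MeasureTheory.volume) (E := ℝ)) (hh 0 x)
      (fun t ht => hnonneg t ⟨ht.1, ht.2.le⟩)
    simpa using this
  have hM : ∫ t in x..y, h t ≤ 0 := by
    have := intervalIntegral.integral_mono_on_of_le_Ioo hxy.le (hh x y)
      (IntervalIntegrable.zero (μ := MeasureTheory.volume) (E := ℝ))
      (fun t ht => by
        have ht1 : t ∈ Ioo (0 : ℝ) 1 := ⟨hx.1.trans ht.1, ht.2.trans hy.2⟩
        rw [hform t ht1]
        refine div_nonpos_of_nonpos_of_nonneg (mul_nonpos_of_nonneg_of_nonpos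
          (Real.exp_pos _).le (sub_nonpos.2 ?_)) ht1.1.le
        exact Real.exp_le_exp.2 (mul_le_mul_of_nonneg_left (hmid t ht) (sub_nonneg.2 hkl)))
    simpa using this
  have hanti : ∀ s, r ≤ s → levelParam p s ∈ Ioc 0 x := by
    intro s hs
    refine ⟨levelParam_pos hp (hr.trans_le hs), ?_⟩
    rw [← hrx]
    refine antitoneOn_of_deriv_nonpos (convex_Ioi 0)
      (fun s hs => (hasDerivAt_levelParam hp hs).continuousAt.continuousWithinAt)
      (fun s hs => ?_) (fun s hs => ?_) (mem_Ioi.2 hr) (mem_Ioi.2 (hr.trans_le hs)) hs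
    · rw [interior_Ioi] at hs
      exact (hasDerivAt_levelParam hp hs).differentiableAt.differentiableWithinAt
    · rw [interior_Ioi] at hs
      rw [(hasDerivAt_levelParam hp hs).deriv]
      exact mul_nonpos_of_nonneg_of_nonpos (levelParam_pos hp hs).le
        (by linarith [levelParamLogDeriv_le hp hp1 hs])
  have hR : ∫ t in y..1, h t ≤ ∫ t in (0 : ℝ)..x, h t := by
    have : ∫ t in y..1, h t ≤ ∫ t in (0 : ℝ)..levelParam p r, h t :=
      integral_right_le_integral_left hp hp1
      ((continuousOn_clopperPearsonDensity.const_smul c).sub continuousOn_clopperPearsonDensity)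
      (hh 0 1) hr (fun s hs => hnonneg _ (hanti s hs)) (fun s hs => by
        have hu := hanti s hs
        have hu1 : levelParam p s ∈ Ioo (0 : ℝ) 1 := ⟨hu.1, hu.2.trans_lt hx.2⟩
        have hv1 : levelParam p s * Real.exp ((1 - p) * s) ∈ Ioo (0 : ℝ) 1 :=
          ⟨mul_pos hu.1 (Real.exp_pos _), levelParam_mul_exp_lt_one hp1 (hr.trans_le hs)⟩
        rw [hform _ hu1, hform _ hv1, binomialLogLik_levelParam hp hp1 (hr.trans_le hs),
          mul_div_cancel₀ _ hu1.1.ne', mul_div_cancel₀ _ hv1.1.ne'])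
    rwa [hrx] at this
  have hsplit1 := intervalIntegral.integral_add_adjacent_intervals (hh 0 x) (hh x 1)
  have hsplit2 := intervalIntegral.integral_add_adjacent_intervals (hh x y) (hh y 1)
  set β := regBeta x (p * k) (k - p * k + 1) with hβ
  have hβ0 : 0 ≤ β := by
    rw [hβ, regBeta_eq]
    exact (div_pos (integral_clopperPearsonDensity_pos hp hp1 hk le_rfl hx.1 hx.2.le) hTk).le
  have hβT : ∫ t in (0 : ℝ)..x, clopperPearsonDensity p k t =
      β * ∫ t in (0 : ℝ)..1, clopperPearsonDensity p k t := by
    rw [hβ, regBeta_eq, div_mul_cancel₀ _ hTk.ne']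
  rw [regBeta_eq, div_le_iff₀ hTl]
  have hA' := hint 0 x
  have hT' := hint 0 1
  rw [hβT] at hA'
  have hbound : β * ∫ t in (0 : ℝ)..1, h t ≤ ∫ t in (0 : ℝ)..x, h t := by
    have h2 : ∫ t in (0 : ℝ)..1, h t ≤ 2 * ∫ t in (0 : ℝ)..x, h t := by linarith
    have := mul_le_mul_of_nonneg_left h2 hβ0
    nlinarith
  rw [hA', hT'] at hbound
  linarith

end Density

/-- With the empirical success fraction held fixed, the one-sided Clopper–Pearson
lower confidence bound is nondecreasing in the sample size. -/
theorem clopperPearson_lower_monotone_in_sample_size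
    (α p : ℝ) (hα : α ∈ Set.Ioo (0:ℝ) (1/2)) (hp : p ∈ Set.Ioo (0:ℝ) 1) :
    MonotoneOn (fun k => betaQuantile α (p * k) (k - p * k + 1)) (Set.Ioi (0:ℝ)) := by
  intro k hk l hl hkl
  obtain ⟨hp0, hp1⟩ := hp
  have hα1 : α ∈ Ioo (0 : ℝ) 1 := ⟨hα.1, hα.2.trans (by norm_num)⟩
  obtain ⟨hxk, hk'⟩ := betaQuantile_spec hp0 hp1 hk hα1
  obtain ⟨hxl, hl'⟩ := betaQuantile_spec hp0 hp1 hl hα1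
  have h := regBeta_le_of_le hp0 hp1 hk hkl hxk (hk'.trans_lt hα.2)
  rw [hk'] at h
  refine ((strictMonoOn_regBeta hp0 hp1 hl).le_iff_le (Ioo_subset_Icc_self hxk)
    (Ioo_subset_Icc_self hxl)).1 ?_
  exact h.trans hl'.ge
end

section
/- Let α ∈ (0, 1/2], p ∈ (0, 1) and k > 0. Then Q(α; p·k, k − p·k + 1) ≤ p; that is, the one-sided Clopper–Pearson lower confidence bound never exceeds the empirical success fraction. -/
open Set Filter

open Real in
/-- Reflecting `t ∈ (p, 1)` to `p ^ 2 / t` increases `p * log t + (1 - p) * log (1 - t)`. -/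
lemma log_likelihood_le_reflect {p t : ℝ} (hp0 : 0 < p) (hpt : p ≤ t) (ht1 : t < 1) :
    p * log t + (1 - p) * log (1 - t) ≤
      p * log (p ^ 2 / t) + (1 - p) * log (1 - p ^ 2 / t) := by
  set D : ℝ → ℝ := fun x =>
    p * log (p ^ 2 / x) + (1 - p) * log (1 - p ^ 2 / x) - (p * log x + (1 - p) * log (1 - x))
    with hD
  have hlt : ∀ x ∈ Ico p 1, 0 < x ∧ 0 < 1 - x ∧ 0 < x - p ^ 2 := by
    rintro x ⟨h1, h2⟩
    exact ⟨by linarith, by linarith, by nlinarith⟩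
  have hderiv : ∀ x ∈ Ico p 1,
      HasDerivAt D ((1 + p) * (x - p) ^ 2 / (x * (x - p ^ 2) * (1 - x))) x := by
    intro x hx
    obtain ⟨h0, h1, h2⟩ := hlt x hx
    have hrefl : 1 - p ^ 2 / x ≠ 0 := by
      rw [one_sub_div h0.ne']
      positivity
    have hd : HasDerivAt (fun y : ℝ => p ^ 2 / y) (-(p ^ 2) / x ^ 2) x := by
      simpa using (hasDerivAt_const x (p ^ 2)).fun_div (hasDerivAt_id x) h0.ne'
    have hl := (((hd.log (by positivity)).const_mul p).add
      (((hd.const_sub 1).log hrefl).const_mul (1 - p))).sub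
      (((hasDerivAt_log h0.ne').const_mul p).add
        ((((hasDerivAt_id x).const_sub 1).log h1.ne').const_mul (1 - p)))
    refine hl.congr_deriv ?_
    rw [one_sub_div h0.ne']
    simp only [id]
    field_simp
    ring
  have hmono : MonotoneOn D (Ico p 1) := by
    refine monotoneOn_of_deriv_nonneg (convex_Ico p 1)
      (fun x hx => (hderiv x hx).continuousAt.continuousWithinAt)
      (fun x hx => (hderiv x (interior_subset hx)).differentiableAt.differentiableWithinAt) ?_
    intro x hx
    obtain ⟨h0, h1, h2⟩ := hlt x (interior_subset hx)
    rw [(hderiv x (interior_subset hx)).deriv]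
    positivity
  have h := hmono ⟨le_rfl, hpt.trans_lt ht1⟩ ⟨hpt, ht1⟩ hpt
  have hself : p ^ 2 / p = p := by field_simp
  simp only [hD, hself] at h
  linarith

/-- The Clopper–Pearson beta density is dominated by its pullback under `t ↦ p ^ 2 / t`. -/
lemma beta_density_le_reflect {p k t : ℝ} (hp0 : 0 < p) (hk : 0 < k) (hpt : p ≤ t)
    (ht1 : t < 1) :
    t ^ (p * k - 1) * (1 - t) ^ (k - p * k) ≤
      (p ^ 2 / t) ^ (p * k - 1) * (1 - p ^ 2 / t) ^ (k - p * k) * (p ^ 2 / t ^ 2) := by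
  have h0 : 0 < t := hp0.trans_le hpt
  have hr : 0 < p ^ 2 / t := by positivity
  have hr1 : 0 < 1 - p ^ 2 / t := by
    rw [one_sub_div h0.ne']
    exact div_pos (by nlinarith) h0
  have key : t ^ (p * k) * (1 - t) ^ (k - p * k) ≤
      (p ^ 2 / t) ^ (p * k) * (1 - p ^ 2 / t) ^ (k - p * k) := by
    rw [Real.rpow_def_of_pos h0, Real.rpow_def_of_pos (sub_pos.2 ht1), Real.rpow_def_of_pos hr,
      Real.rpow_def_of_pos hr1, ← Real.exp_add, ← Real.exp_add, Real.exp_le_exp]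
    have := mul_le_mul_of_nonneg_left (log_likelihood_le_reflect hp0 hpt ht1) hk.le
    linarith
  rw [Real.rpow_sub_one h0.ne', Real.rpow_sub_one hr.ne']
  calc t ^ (p * k) / t * (1 - t) ^ (k - p * k)
      = t ^ (p * k) * (1 - t) ^ (k - p * k) / t := by ring
    _ ≤ (p ^ 2 / t) ^ (p * k) * (1 - p ^ 2 / t) ^ (k - p * k) / t := by gcongr
    _ = _ := by field_simp

lemma intervalIntegrable_beta_density {a c : ℝ} (ha : 0 < a) (hc : 0 ≤ c) (x y : ℝ) :
    IntervalIntegrable (fun t : ℝ => t ^ (a - 1) * (1 - t) ^ c) MeasureTheory.volume x y :=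
  (intervalIntegral.intervalIntegrable_rpow' (by linarith)).mul_continuousOn
    ((continuous_const.sub continuous_id).rpow_const fun _ => Or.inr hc).continuousOn

/-- The upper tail mass beyond the success fraction is at most the lower one. -/
lemma beta_upper_tail_le_lower {p k : ℝ} (hp : p ∈ Ioo (0 : ℝ) 1) (hk : 0 < k) :
    ∫ t in p..1, t ^ (p * k - 1) * (1 - t) ^ (k - p * k) ≤
      ∫ t in (0 : ℝ)..p, t ^ (p * k - 1) * (1 - t) ^ (k - p * k) := by
  obtain ⟨hp0, hp1⟩ := hp
  have hc : 0 ≤ k - p * k := by nlinarith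
  set f : ℝ → ℝ := fun t => t ^ (p * k - 1) * (1 - t) ^ (k - p * k)
  have hint : ∀ x y, IntervalIntegrable f MeasureTheory.volume x y :=
    intervalIntegrable_beta_density (mul_pos hp0 hk) hc
  have hfc : ContinuousOn f (Ioi 0) :=
    (continuousOn_id.rpow_const fun x hx => Or.inl (ne_of_gt hx)).mul
      ((continuous_const.sub continuous_id).rpow_const fun _ => Or.inr hc).continuousOn
  have hpos : ∀ x ∈ uIcc p 1, 0 < x := fun x hx => by
    rw [uIcc_of_le hp1.le] at hx
    exact hp0.trans_le hx.1
  have hreflc : ContinuousOn (fun t : ℝ => p ^ 2 / t) (uIcc p 1) :=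
    continuousOn_const.div continuousOn_id fun x hx => (hpos x hx).ne'
  have hdc : ContinuousOn (fun t : ℝ => -(p ^ 2) / t ^ 2) (uIcc p 1) :=
    continuousOn_const.div (continuousOn_id.pow 2) fun x hx => pow_ne_zero 2 (hpos x hx).ne'
  have hmaps : MapsTo (fun t : ℝ => p ^ 2 / t) (uIcc p 1) (Ioi 0) :=
    fun x hx => div_pos (by positivity) (hpos x hx)
  have hsub : ∫ t in p..1, (f ∘ fun t => p ^ 2 / t) t * (-(p ^ 2) / t ^ 2) =
      ∫ t in p ^ 2 / p..p ^ 2 / 1, f t :=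
    intervalIntegral.integral_comp_mul_deriv' (f := fun t : ℝ => p ^ 2 / t)
      (fun x hx => by
        simpa using (hasDerivAt_const x (p ^ 2)).fun_div (hasDerivAt_id x) (hpos x hx).ne')
      hdc (hfc.mono hmaps.image_subset)
  have hself : p ^ 2 / p = p := by field_simp
  rw [hself, div_one, intervalIntegral.integral_symm (p ^ 2) p] at hsub
  have hsub' : ∫ t in p..1, f (p ^ 2 / t) * (p ^ 2 / t ^ 2) = ∫ t in p ^ 2..p, f t := by
    rw [← neg_inj, ← hsub, ← intervalIntegral.integral_neg]
    congr 1
    ext t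
    simp only [Function.comp_apply]
    ring
  have hgint : IntervalIntegrable (fun t => f (p ^ 2 / t) * (p ^ 2 / t ^ 2))
      MeasureTheory.volume p 1 := by
    refine ContinuousOn.intervalIntegrable ((hfc.comp hreflc hmaps).mul ?_)
    exact continuousOn_const.div (continuousOn_id.pow 2)
      fun x hx => pow_ne_zero 2 (hpos x hx).ne'
  have hmono : ∫ t in p..1, f t ≤ ∫ t in p..1, f (p ^ 2 / t) * (p ^ 2 / t ^ 2) :=
    intervalIntegral.integral_mono_on_of_le_Ioo hp1.le (hint _ _) hgint
      fun t ht => beta_density_le_reflect hp0 hk ht.1.le ht.2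
  have hsplit := intervalIntegral.integral_add_adjacent_intervals (hint 0 (p ^ 2)) (hint (p ^ 2) p)
  have hnonneg : 0 ≤ ∫ t in (0 : ℝ)..p ^ 2, f t := by
    refine intervalIntegral.integral_nonneg (by positivity) fun t ht => ?_
    have : 0 ≤ 1 - t := by nlinarith [ht.2]
    exact mul_nonneg (Real.rpow_nonneg ht.1 _) (Real.rpow_nonneg this _)
  linarith

lemma half_le_regBeta_fraction {p k : ℝ} (hp : p ∈ Ioo (0 : ℝ) 1) (hk : 0 < k) :
    1 / 2 ≤ regBeta p (p * k) (k - p * k + 1) := by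
  have hc : 0 ≤ k - p * k := by nlinarith [hp.2]
  have ha : 0 < p * k := mul_pos hp.1 hk
  have hint := intervalIntegrable_beta_density ha hc
  have hsplit := intervalIntegral.integral_add_adjacent_intervals (hint 0 p) (hint p 1)
  have hpos : 0 < ∫ t in (0 : ℝ)..1, t ^ (p * k - 1) * (1 - t) ^ (k - p * k) :=
    intervalIntegral.intervalIntegral_pos_of_pos_on (hint 0 1)
      (fun t ht => mul_pos (Real.rpow_pos_of_pos ht.1 _)
        (Real.rpow_pos_of_pos (sub_pos.2 ht.2) _)) one_pos
  have htail := beta_upper_tail_le_lower hp hk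
  simp only [regBeta, betaFn, add_sub_cancel_right]
  rw [le_div_iff₀ hpos]
  linarith

/-- The one-sided Clopper–Pearson lower confidence bound never exceeds the
empirical success fraction. -/
theorem clopperPearson_lower_le_fraction
    (α p k : ℝ) (hα : α ∈ Set.Ioc (0:ℝ) (1/2)) (hp : p ∈ Set.Ioo (0:ℝ) 1)
    (hk : 0 < k) :
    betaQuantile α (p * k) (k - p * k + 1) ≤ p := by
  have hc : 0 ≤ k - p * k := by nlinarith [hp.2]
  have ha : 0 < p * k := mul_pos hp.1 hk
  have hcont : Continuous fun x => regBeta x (p * k) (k - p * k + 1) := by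
    simp only [regBeta, add_sub_cancel_right]
    exact (intervalIntegral.continuous_primitive
      (intervalIntegrable_beta_density ha hc) 0).div_const _
  have hzero : regBeta 0 (p * k) (k - p * k + 1) = 0 := by simp [regBeta]
  obtain ⟨x, hx, hxα⟩ := intermediate_value_Icc hp.1.le hcont.continuousOn
    ⟨hzero.trans_le hα.1.le, hα.2.trans (half_le_regBeta_fraction hp hk)⟩
  have hx0 : x ≠ 0 := by
    rintro rfl
    exact hα.1.ne (hzero.symm.trans hxα)
  refine (csInf_le ⟨0, fun y hy => hy.1.1.le⟩ ?_).trans hx.2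
  exact ⟨⟨lt_of_le_of_ne hx.1 hx0.symm, hx.2.trans_lt hp.2⟩, hxα⟩
end

section
/- Let α ∈ (0, 1) and p ∈ (0, 1). Then Q(α; p·k, k − p·k + 1) → p as k → ∞; consequently, for fixed σ > 0 the estimated certified radius σ·Φ⁻¹(Q(α; p·k, k − p·k + 1)) converges to the optimal radius σ·Φ⁻¹(p) as the sample size k tends to infinity. -/
open Set Filter

/-- The unnormalized Beta density. -/
noncomputable def betaKernel (a b t : ℝ) : ℝ := t ^ (a - 1) * (1 - t) ^ (b - 1)

theorem continuous_betaKernel {a b : ℝ} (ha : 1 ≤ a) (hb : 1 ≤ b) :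
    Continuous (betaKernel a b) := by
  unfold betaKernel
  exact (Real.continuous_rpow_const (by linarith)).mul
    ((Real.continuous_rpow_const (by linarith)).comp (by fun_prop))

theorem betaKernel_nonneg {a b t : ℝ} (ht : t ∈ Icc (0:ℝ) 1) : 0 ≤ betaKernel a b t :=
  mul_nonneg (Real.rpow_nonneg ht.1 _) (Real.rpow_nonneg (by linarith [ht.2]) _)

theorem betaFn_pos {a b : ℝ} (ha : 1 ≤ a) (hb : 1 ≤ b) : 0 < betaFn a b := by
  refine intervalIntegral.intervalIntegral_pos_of_pos_on
    ((continuous_betaKernel ha hb).intervalIntegrable 0 1) (fun t ht => ?_) one_pos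
  exact mul_pos (Real.rpow_pos_of_pos ht.1 _) (Real.rpow_pos_of_pos (by linarith [ht.2]) _)

/-- Integrating the derivative of `t ^ a * (1 - t) ^ b` over `[0, 1]` gives zero. -/
theorem integral_betaKernel_parts {a b : ℝ} (ha : 1 ≤ a) (hb : 1 ≤ b) :
    ∫ t in (0:ℝ)..1, (a - (a + b) * t) * betaKernel a b t = 0 := by
  have hderiv : ∀ t ∈ Ioo (0:ℝ) 1, HasDerivAt (fun t : ℝ => t ^ a * (1 - t) ^ b)
      ((a - (a + b) * t) * betaKernel a b t) t := by
    intro t ht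
    have h1 := (Real.hasDerivAt_rpow_const (x := t) (p := a) (Or.inr ha))
    have h2 := ((hasDerivAt_id t).const_sub 1).rpow_const (p := b) (Or.inr hb)
    have h3 := h1.mul h2
    refine h3.congr_deriv ?_
    have e1 : t ^ a = t ^ (a - 1) * t := by
      rw [← Real.rpow_add_one ht.1.ne']; simp
    have e2 : (1 - t) ^ b = (1 - t) ^ (b - 1) * (1 - t) := by
      rw [← Real.rpow_add_one (by linarith [ht.2])]; simp
    simp only [id, betaKernel]
    rw [e1, e2]
    ring
  have hcont : Continuous (fun t : ℝ => t ^ a * (1 - t) ^ b) :=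
    (Real.continuous_rpow_const (by linarith)).mul
      ((Real.continuous_rpow_const (by linarith)).comp (by fun_prop))
  have hk := continuous_betaKernel ha hb
  rw [intervalIntegral.integral_eq_sub_of_hasDerivAt_of_le zero_le_one hcont.continuousOn hderiv
    ((by fun_prop : Continuous fun t => (a - (a + b) * t) * betaKernel a b t).intervalIntegrable
      0 1)]
  simp [Real.zero_rpow (by linarith : a ≠ 0), Real.zero_rpow (by linarith : b ≠ 0)]

theorem integral_id_mul_betaKernel {a b : ℝ} (ha : 1 ≤ a) (hb : 1 ≤ b) :
    ∫ t in (0:ℝ)..1, t * betaKernel a b t = a / (a + b) * betaFn a b := by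
  have hk := continuous_betaKernel ha hb
  have h := integral_betaKernel_parts ha hb
  have h2 : ∫ t in (0:ℝ)..1, (a - (a + b) * t) * betaKernel a b t =
      a * betaFn a b - (a + b) * ∫ t in (0:ℝ)..1, t * betaKernel a b t := by
    have hM : betaFn a b = ∫ t in (0:ℝ)..1, betaKernel a b t := rfl
    rw [hM, ← intervalIntegral.integral_const_mul, ← intervalIntegral.integral_const_mul,
      ← intervalIntegral.integral_sub]
    · congr 1; ext t; ring
    · exact Continuous.intervalIntegrable (by fun_prop) _ _
    · exact Continuous.intervalIntegrable (by fun_prop) _ _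
  have hab : a + b ≠ 0 := by linarith
  field_simp
  linarith

theorem betaKernel_add_one_left {a b t : ℝ} (ha : 1 ≤ a) (ht : 0 ≤ t) :
    betaKernel (a + 1) b t = t * betaKernel a b t := by
  unfold betaKernel
  rw [show a + 1 - 1 = (a - 1) + 1 by ring, Real.rpow_add_one' ht (by linarith)]
  ring

theorem betaFn_add_one_left {a b : ℝ} (ha : 1 ≤ a) (hb : 1 ≤ b) :
    betaFn (a + 1) b = a / (a + b) * betaFn a b := by
  rw [← integral_id_mul_betaKernel ha hb]
  refine intervalIntegral.integral_congr (fun t ht => ?_)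
  rw [uIcc_of_le zero_le_one] at ht
  exact betaKernel_add_one_left ha ht.1

theorem integral_sq_mul_betaKernel {a b : ℝ} (ha : 1 ≤ a) (hb : 1 ≤ b) :
    ∫ t in (0:ℝ)..1, t ^ 2 * betaKernel a b t =
      (a + 1) / (a + 1 + b) * (a / (a + b)) * betaFn a b := by
  rw [mul_assoc, ← betaFn_add_one_left ha hb,
    ← integral_id_mul_betaKernel (a := a + 1) (by linarith) hb]
  refine intervalIntegral.integral_congr (fun t ht => ?_)
  rw [uIcc_of_le zero_le_one] at ht
  simp only [betaKernel_add_one_left ha ht.1]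
  ring

/-- The mean square deviation from `p` of the Beta distribution. -/
theorem integral_sub_sq_mul_betaKernel {a b : ℝ} (ha : 1 ≤ a) (hb : 1 ≤ b) (p : ℝ) :
    ∫ t in (0:ℝ)..1, (t - p) ^ 2 * betaKernel a b t =
      ((a + 1) / (a + 1 + b) * (a / (a + b)) - 2 * p * (a / (a + b)) + p ^ 2) * betaFn a b := by
  have hk := continuous_betaKernel ha hb
  have hM : betaFn a b = ∫ t in (0:ℝ)..1, betaKernel a b t := rfl
  have h : ∫ t in (0:ℝ)..1, (t - p) ^ 2 * betaKernel a b t =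
      (∫ t in (0:ℝ)..1, t ^ 2 * betaKernel a b t) -
        2 * p * (∫ t in (0:ℝ)..1, t * betaKernel a b t) +
        p ^ 2 * ∫ t in (0:ℝ)..1, betaKernel a b t := by
    rw [← intervalIntegral.integral_const_mul, ← intervalIntegral.integral_const_mul,
      ← intervalIntegral.integral_sub, ← intervalIntegral.integral_add]
    · congr 1; ext t; ring
    all_goals exact Continuous.intervalIntegrable (by fun_prop) _ _
  rw [h, integral_sq_mul_betaKernel ha hb, integral_id_mul_betaKernel ha hb, ← hM]
  ring

theorem continuous_regBeta {a b : ℝ} (ha : 1 ≤ a) (hb : 1 ≤ b) :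
    Continuous (fun x => regBeta x a b) :=
  (intervalIntegral.continuous_primitive
    (fun _ _ => (continuous_betaKernel ha hb).intervalIntegrable _ _) 0).div_const _

theorem regBeta_sub {a b : ℝ} (ha : 1 ≤ a) (hb : 1 ≤ b) (x y : ℝ) :
    regBeta y a b - regBeta x a b = (∫ t in x..y, betaKernel a b t) / betaFn a b := by
  have hk := continuous_betaKernel ha hb
  rw [← intervalIntegral.integral_interval_sub_left (hk.intervalIntegrable 0 y)
    (hk.intervalIntegrable 0 x), sub_div]
  rfl

theorem regBeta_zero (a b : ℝ) : regBeta 0 a b = 0 := by simp [regBeta]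

theorem regBeta_one {a b : ℝ} (ha : 1 ≤ a) (hb : 1 ≤ b) : regBeta 1 a b = 1 :=
  div_self (betaFn_pos ha hb).ne'

theorem monotoneOn_regBeta {a b : ℝ} (ha : 1 ≤ a) (hb : 1 ≤ b) :
    MonotoneOn (fun x => regBeta x a b) (Icc 0 1) := by
  intro x hx y hy hxy
  have h : 0 ≤ regBeta y a b - regBeta x a b := by
    rw [regBeta_sub ha hb]
    exact div_nonneg (intervalIntegral.integral_nonneg hxy fun t ht =>
      betaKernel_nonneg ⟨hx.1.trans ht.1, ht.2.trans hy.2⟩) (betaFn_pos ha hb).le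
  simpa using h

/-- Chebyshev's inequality for the Beta distribution on an interval at distance at least `d`
from `p`. -/
theorem regBeta_sub_le {a b p x y d : ℝ} (ha : 1 ≤ a) (hb : 1 ≤ b) (hx : 0 ≤ x) (hxy : x ≤ y)
    (hy : y ≤ 1) (hd : 0 < d) (hdist : ∀ t ∈ Icc x y, d ≤ |t - p|) :
    regBeta y a b - regBeta x a b ≤
      ((a + 1) / (a + 1 + b) * (a / (a + b)) - 2 * p * (a / (a + b)) + p ^ 2) / d ^ 2 := by
  have hk := continuous_betaKernel ha hb
  have hB := betaFn_pos ha hb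
  have hq : Continuous fun t => (t - p) ^ 2 * betaKernel a b t := by fun_prop
  rw [regBeta_sub ha hb, div_le_div_iff₀ hB (by positivity),
    ← integral_sub_sq_mul_betaKernel ha hb]
  calc (∫ t in x..y, betaKernel a b t) * d ^ 2
      = ∫ t in x..y, d ^ 2 * betaKernel a b t := by
        rw [intervalIntegral.integral_const_mul]; ring
    _ ≤ ∫ t in x..y, (t - p) ^ 2 * betaKernel a b t := by
        refine intervalIntegral.integral_mono_on hxy
          (Continuous.intervalIntegrable (by fun_prop) _ _) (hq.intervalIntegrable _ _) ?_
        intro t ht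
        refine mul_le_mul_of_nonneg_right ?_
          (betaKernel_nonneg ⟨hx.trans ht.1, ht.2.trans hy⟩)
        rw [← sq_abs (t - p)]
        exact pow_le_pow_left₀ hd.le (hdist t ht) 2
    _ ≤ ∫ t in (0:ℝ)..1, (t - p) ^ 2 * betaKernel a b t := by
        refine intervalIntegral.integral_mono_interval hx hxy hy ?_ (hq.intervalIntegrable _ _)
        refine (MeasureTheory.ae_restrict_iff' measurableSet_Ioc).2 (Eventually.of_forall ?_)
        intro t ht
        exact mul_nonneg (sq_nonneg _) (betaKernel_nonneg ⟨ht.1.le, ht.2⟩)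

theorem betaQuantile_mem_Icc {α a b x y : ℝ} (ha : 1 ≤ a) (hb : 1 ≤ b) (hx : 0 < x)
    (hxy : x ≤ y) (hy : y < 1) (hxα : regBeta x a b < α) (hyα : α < regBeta y a b) :
    betaQuantile α a b ∈ Icc x y := by
  obtain ⟨z, hz, hzα⟩ := intermediate_value_Icc hxy (continuous_regBeta ha hb).continuousOn
    ⟨hxα.le, hyα.le⟩
  have hzS : z ∈ {x : ℝ | x ∈ Set.Ioo (0:ℝ) 1 ∧ regBeta x a b = α} :=
    ⟨⟨hx.trans_le hz.1, hz.2.trans_lt hy⟩, hzα⟩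
  have hlow : ∀ w ∈ {x : ℝ | x ∈ Set.Ioo (0:ℝ) 1 ∧ regBeta x a b = α}, x ≤ w := by
    rintro w ⟨hw, hwα⟩
    by_contra! hlt
    have := monotoneOn_regBeta ha hb ⟨hw.1.le, hw.2.le⟩ ⟨hx.le, (hxy.trans_lt hy).le⟩ hlt.le
    simp only at this
    linarith
  exact ⟨le_csInf ⟨z, hzS⟩ hlow, (csInf_le ⟨x, hlow⟩ hzS).trans hz.2⟩

theorem tendsto_linear_div_linear (p c d : ℝ) :
    Tendsto (fun k : ℝ => (p * k + c) / (k + d)) atTop (nhds p) := by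
  have hd : Tendsto (fun k : ℝ => k + d) atTop atTop := tendsto_atTop_add_const_right _ _ tendsto_id
  have h := (hd.inv_tendsto_atTop.const_mul (c - p * d)).const_add p
  rw [mul_zero, add_zero] at h
  refine h.congr' ?_
  filter_upwards [hd.eventually_gt_atTop 0] with k hk
  simp only [Pi.inv_apply]
  field_simp
  ring

theorem tendsto_betaQuantile {α p : ℝ} (hα : α ∈ Ioo (0:ℝ) 1) (hp : p ∈ Ioo (0:ℝ) 1) :
    Tendsto (fun k : ℝ => betaQuantile α (p * k) (k - p * k + 1)) atTop (nhds p) := by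
  have hV : Tendsto (fun k : ℝ => (p * k + 1) / (p * k + 1 + (k - p * k + 1)) *
      (p * k / (p * k + (k - p * k + 1))) - 2 * p * (p * k / (p * k + (k - p * k + 1))) + p ^ 2)
      atTop (nhds 0) := by
    have h1 := tendsto_linear_div_linear p 0 1
    have h2 := tendsto_linear_div_linear p 1 2
    have h := ((h2.mul h1).sub (h1.const_mul (2 * p))).add_const (p ^ 2)
    rw [show p * p - 2 * p * p + p ^ 2 = 0 by ring] at h
    refine h.congr (fun k => ?_)
    rw [show p * k + 1 + (k - p * k + 1) = k + 2 by ring,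
      show p * k + (k - p * k + 1) = k + 1 by ring, add_zero]
  have hpk : ∀ᶠ k : ℝ in atTop, 1 ≤ p * k :=
    (tendsto_id.const_mul_atTop hp.1).eventually_ge_atTop 1
  have hbig : ∀ x ∈ Ioo 0 p, ∀ y ∈ Ioo p 1,
      ∀ᶠ k : ℝ in atTop, betaQuantile α (p * k) (k - p * k + 1) ∈ Icc x y := by
    intro x hx y hy
    have hVx := hV.div_const ((p - x) ^ 2)
    have hVy := hV.div_const ((y - p) ^ 2)
    rw [zero_div] at hVx hVy
    filter_upwards [hpk, eventually_ge_atTop 0, hVx.eventually_lt_const hα.1,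
      hVy.eventually_lt_const (sub_pos.2 hα.2)] with k ha hk hkx hky
    have hb : 1 ≤ k - p * k + 1 := by nlinarith [hp.2]
    refine betaQuantile_mem_Icc ha hb hx.1 (hx.2.trans hy.1).le hy.2 ?_ ?_
    · have h := regBeta_sub_le (p := p) (d := p - x) ha hb le_rfl hx.1.le
        (hx.2.trans hp.2).le (sub_pos.2 hx.2)
        (fun t ht => by
          rw [abs_sub_comm]
          exact (by linarith [ht.2] : _ ≤ p - t).trans (le_abs_self _))
      rw [regBeta_zero] at h
      linarith
    · have h := regBeta_sub_le (p := p) (d := y - p) ha hb (hp.1.trans hy.1).le hy.2.le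
        le_rfl (sub_pos.2 hy.1)
        (fun t ht => (by linarith [ht.1] : _ ≤ t - p).trans (le_abs_self _))
      rw [regBeta_one ha hb] at h
      linarith
  refine tendsto_order.2 ⟨fun l hl => ?_, fun u hu => ?_⟩
  · obtain ⟨x, hx1, hx2⟩ := exists_between (max_lt hl hp.1)
    obtain ⟨y, hy⟩ := exists_between hp.2
    filter_upwards [hbig x ⟨(le_max_right _ _).trans_lt hx1, hx2⟩ y hy] with k hk
    exact ((le_max_left _ _).trans_lt hx1).trans_le hk.1
  · obtain ⟨y, hy1, hy2⟩ := exists_between (lt_min hu hp.2)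
    obtain ⟨x, hx⟩ := exists_between hp.1
    filter_upwards [hbig x hx y ⟨hy1, hy2.trans_le (min_le_right _ _)⟩] with k hk
    exact hk.2.trans_lt (hy2.trans_le (min_le_left _ _))

theorem gaussianPDFReal_zero_one_eq :
    ProbabilityTheory.gaussianPDFReal 0 1 =
      fun s : ℝ => (Real.sqrt (2 * Real.pi))⁻¹ * Real.exp (-(s ^ 2) / 2) := by
  ext s
  simp [ProbabilityTheory.gaussianPDFReal]

theorem stdGaussCDF_eq_cdf :
    stdGaussCDF = ProbabilityTheory.cdf (ProbabilityTheory.gaussianReal 0 1) := by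
  ext t
  rw [ProbabilityTheory.cdf_eq_real, MeasureTheory.measureReal_def,
    ProbabilityTheory.gaussianReal_apply_eq_integral 0 one_ne_zero,
    ENNReal.toReal_ofReal (MeasureTheory.setIntegral_nonneg measurableSet_Iic
      fun s _ => ProbabilityTheory.gaussianPDFReal_nonneg 0 1 s), gaussianPDFReal_zero_one_eq]
  rfl

theorem stdGaussCDF_sub (x y : ℝ) :
    stdGaussCDF y - stdGaussCDF x =
      ∫ s in x..y, ProbabilityTheory.gaussianPDFReal 0 1 s := by
  have hint := ProbabilityTheory.integrable_gaussianPDFReal 0 1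
  rw [← intervalIntegral.integral_Iic_sub_Iic hint.integrableOn hint.integrableOn,
    gaussianPDFReal_zero_one_eq]
  rfl

theorem strictMono_stdGaussCDF : StrictMono stdGaussCDF := by
  intro x y hxy
  rw [← sub_pos, stdGaussCDF_sub]
  exact intervalIntegral.intervalIntegral_pos_of_pos_on
    (ProbabilityTheory.integrable_gaussianPDFReal 0 1).intervalIntegrable
    (fun s _ => ProbabilityTheory.gaussianPDFReal_pos 0 1 s one_ne_zero) hxy

theorem continuous_stdGaussCDF : Continuous stdGaussCDF := by
  have h : stdGaussCDF = fun t => stdGaussCDF 0 +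
      ∫ s in (0:ℝ)..t, ProbabilityTheory.gaussianPDFReal 0 1 s := by
    ext t
    rw [← stdGaussCDF_sub]
    ring
  rw [h]
  exact continuous_const.add (intervalIntegral.continuous_primitive
    (fun _ _ => (ProbabilityTheory.integrable_gaussianPDFReal 0 1).intervalIntegrable) 0)

theorem exists_stdGaussCDF_eq {p : ℝ} (hp : p ∈ Ioo (0:ℝ) 1) : ∃ z, stdGaussCDF z = p := by
  have hbot : Tendsto stdGaussCDF atBot (nhds 0) := by
    rw [stdGaussCDF_eq_cdf]; exact ProbabilityTheory.tendsto_cdf_atBot _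
  have htop : Tendsto stdGaussCDF atTop (nhds 1) := by
    rw [stdGaussCDF_eq_cdf]; exact ProbabilityTheory.tendsto_cdf_atTop _
  obtain ⟨x, hx⟩ := (hbot.eventually_lt_const hp.1).exists
  obtain ⟨y, hy⟩ := (htop.eventually_const_lt hp.2).exists
  exact mem_range_of_exists_le_of_exists_ge continuous_stdGaussCDF ⟨x, hx.le⟩ ⟨y, hy.le⟩

theorem stdGaussCDFInv_stdGaussCDF (z : ℝ) : stdGaussCDFInv (stdGaussCDF z) = z :=
  Function.leftInverse_invFun strictMono_stdGaussCDF.injective z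

theorem continuousAt_stdGaussCDFInv {p : ℝ} (hp : p ∈ Ioo (0:ℝ) 1) :
    ContinuousAt stdGaussCDFInv p := by
  obtain ⟨z, rfl⟩ := exists_stdGaussCDF_eq hp
  rw [ContinuousAt, stdGaussCDFInv_stdGaussCDF]
  refine tendsto_order.2 ⟨fun l hl => ?_, fun u hu => ?_⟩
  · filter_upwards [Ioo_mem_nhds hp.1 hp.2, lt_mem_nhds (strictMono_stdGaussCDF hl)] with q hq hlq
    obtain ⟨w, rfl⟩ := exists_stdGaussCDF_eq hq
    rw [stdGaussCDFInv_stdGaussCDF]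
    exact strictMono_stdGaussCDF.lt_iff_lt.1 hlq
  · filter_upwards [Ioo_mem_nhds hp.1 hp.2, gt_mem_nhds (strictMono_stdGaussCDF hu)] with q hq huq
    obtain ⟨w, rfl⟩ := exists_stdGaussCDF_eq hq
    rw [stdGaussCDFInv_stdGaussCDF]
    exact strictMono_stdGaussCDF.lt_iff_lt.1 huq

/-- The Clopper–Pearson lower bound converges to the success fraction as the
sample size tends to infinity; consequently the estimated certified radius
converges to the optimal radius. -/
theorem clopperPearson_lower_tendsto
    (α p : ℝ) (hα : α ∈ Set.Ioo (0:ℝ) 1) (hp : p ∈ Set.Ioo (0:ℝ) 1) :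
    Filter.Tendsto (fun k : ℝ => betaQuantile α (p * k) (k - p * k + 1))
      Filter.atTop (nhds p) ∧
    ∀ σ : ℝ, 0 < σ →
      Filter.Tendsto
        (fun k : ℝ => σ * stdGaussCDFInv (betaQuantile α (p * k) (k - p * k + 1)))
        Filter.atTop (nhds (σ * stdGaussCDFInv p)) := by
  have h := tendsto_betaQuantile hα hp
  exact ⟨h, fun σ _ => ((continuousAt_stdGaussCDFInv hp).tendsto.comp h).const_mul σ⟩
end

section
/- Let n ∈ ℕ with n ≥ 1, p ∈ (0,1) and α ∈ (0,1). Define the two-sided Clopper–Pearson bounds L(m) := Q(α/2; m, n − m + 1) for 1 ≤ m ≤ n with L(0) := 0, and U(m) := Q(1 − α/2; m + 1, n − m) for 0 ≤ m ≤ n − 1 with U(n) := 1. Then the coverage guarantee holds: ∑_{m ∈ {0,…,n} : L(m) ≤ p ≤ U(m)} C(n,m)·p^m·(1−p)^(n−m) ≥ 1 − α; that is, if K is Binomial(n,p) distributed, then p ∈ [L(K), U(K)] with probability at least 1 − α. -/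
open Set Filter

/-- The upper tail `P(K ≥ m)` of a Binomial(`n`, `x`) random variable `K`. -/
noncomputable def binomialTail (n m : ℕ) (x : ℝ) : ℝ :=
  ∑ k ∈ Finset.Ico m (n + 1), (n.choose k : ℝ) * x ^ k * (1 - x) ^ (n - k)

theorem hasDerivAt_binomialTail {n m : ℕ} (hmn : m ≤ n) (x : ℝ) :
    HasDerivAt (binomialTail n m)
      ((m * n.choose m : ℝ) * (x ^ (m - 1) * (1 - x) ^ (n - m))) x := by
  set g : ℕ → ℝ := fun k => (k * n.choose k : ℝ) * (x ^ (k - 1) * (1 - x) ^ (n - k)) with hg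
  have hterm (k : ℕ) (hk : k ≤ n) :
      HasDerivAt (fun y : ℝ => (n.choose k : ℝ) * y ^ k * (1 - y) ^ (n - k))
        (-(g (k + 1) - g k)) x := by
    have h1 := (hasDerivAt_pow k x).const_mul (n.choose k : ℝ)
    have h2 := ((hasDerivAt_id x).const_sub 1).pow (n - k)
    refine (h1.mul h2).congr_deriv ?_
    have hc : (n.choose (k + 1) : ℝ) * ((k : ℝ) + 1) = n.choose k * ((n - k : ℕ) : ℝ) := by
      exact_mod_cast Nat.choose_succ_right_eq n k
    have hs : n - (k + 1) = n - k - 1 := by omega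
    simp only [hg, Nat.add_sub_cancel, hs, Nat.cast_add, Nat.cast_one, id, Pi.pow_apply]
    linear_combination (x ^ k * (1 - x) ^ (n - k - 1)) * hc
  have hsum := HasDerivAt.fun_sum (u := Finset.Ico m (n + 1))
    fun k hk => hterm k (Nat.lt_succ_iff.mp (Finset.mem_Ico.mp hk).2)
  refine hsum.congr_deriv ?_
  rw [Finset.sum_neg_distrib, Finset.sum_Ico_sub g (by omega)]
  simp [hg]

theorem continuous_binomialTail (n m : ℕ) : Continuous (binomialTail n m) := by
  unfold binomialTail
  fun_prop

theorem binomialTail_zero {n m : ℕ} (hm : 1 ≤ m) : binomialTail n m 0 = 0 := by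
  refine Finset.sum_eq_zero fun k hk => ?_
  have : k ≠ 0 := by have := (Finset.mem_Ico.mp hk).1; omega
  simp [this]

theorem binomialTail_one {n m : ℕ} (hmn : m ≤ n) : binomialTail n m 1 = 1 := by
  unfold binomialTail
  rw [Finset.sum_eq_single_of_mem n (Finset.mem_Ico.mpr ⟨hmn, n.lt_succ_self⟩)]
  · simp
  · intro k hk hkn
    have : n - k ≠ 0 := by have := (Finset.mem_Ico.mp hk).2; omega
    simp [this]

theorem sum_range_binomial (n : ℕ) (x : ℝ) :
    ∑ k ∈ Finset.range (n + 1), (n.choose k : ℝ) * x ^ k * (1 - x) ^ (n - k) = 1 := by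
  have h := add_pow x (1 - x) n
  rw [add_sub_cancel, one_pow] at h
  exact (Finset.sum_congr rfl fun k _ => by ac_rfl).trans h.symm

theorem sum_range_add_binomialTail {n m : ℕ} (hmn : m ≤ n + 1) (x : ℝ) :
    (∑ k ∈ Finset.range m, (n.choose k : ℝ) * x ^ k * (1 - x) ^ (n - k)) +
      binomialTail n m x = 1 := by
  rw [binomialTail, Finset.sum_range_add_sum_Ico _ hmn, sum_range_binomial]

theorem strictMonoOn_binomialTail {n m : ℕ} (hm : 1 ≤ m) (hmn : m ≤ n) :
    StrictMonoOn (binomialTail n m) (Icc 0 1) := by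
  refine strictMonoOn_of_deriv_pos (convex_Icc 0 1) (continuous_binomialTail n m).continuousOn ?_
  intro x hx
  rw [interior_Icc] at hx
  rw [(hasDerivAt_binomialTail hmn x).deriv]
  have h1 : (0 : ℝ) < m := by exact_mod_cast hm
  have h2 : (0 : ℝ) < n.choose m := by exact_mod_cast Nat.choose_pos hmn
  have h3 : 0 < 1 - x := sub_pos.mpr hx.2
  have h4 : 0 < x := hx.1
  positivity

theorem integral_beta_kernel {n m : ℕ} (hm : 1 ≤ m) (hmn : m ≤ n) (x : ℝ) :
    (m * n.choose m : ℝ) * ∫ t in (0 : ℝ)..x,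
      t ^ ((m : ℝ) - 1) * (1 - t) ^ ((n : ℝ) - m + 1 - 1) = binomialTail n m x := by
  have e1 : (m : ℝ) - 1 = ((m - 1 : ℕ) : ℝ) := by push_cast [hm]; ring
  have e2 : (n : ℝ) - m + 1 - 1 = ((n - m : ℕ) : ℝ) := by push_cast [hmn]; ring
  simp only [e1, e2, Real.rpow_natCast]
  rw [← intervalIntegral.integral_const_mul,
    intervalIntegral.integral_eq_sub_of_hasDerivAt
      (fun t _ => hasDerivAt_binomialTail hmn t)
      (Continuous.intervalIntegrable (by fun_prop) _ _),
    binomialTail_zero hm, sub_zero]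

/-- The regularized incomplete Beta function at integer parameters is a binomial tail. -/
theorem regBeta_eq_binomialTail {n m : ℕ} (hm : 1 ≤ m) (hmn : m ≤ n) (x : ℝ) :
    regBeta x m ((n : ℝ) - m + 1) = binomialTail n m x := by
  have h1 := integral_beta_kernel hm hmn 1
  rw [binomialTail_one hmn] at h1
  rw [regBeta, betaFn, div_eq_iff (right_ne_zero_of_mul_eq_one h1), ← integral_beta_kernel hm hmn x]
  linear_combination -(∫ t in (0 : ℝ)..x,
      t ^ ((m : ℝ) - 1) * (1 - t) ^ ((n : ℝ) - m + 1 - 1)) * h1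

theorem betaQuantile_spec_s15 {n m : ℕ} (hm : 1 ≤ m) (hmn : m ≤ n) {a : ℝ} (ha : a ∈ Ioo (0 : ℝ) 1) :
    betaQuantile a m ((n : ℝ) - m + 1) ∈ Ioo (0 : ℝ) 1 ∧
      binomialTail n m (betaQuantile a m ((n : ℝ) - m + 1)) = a := by
  have hivt := intermediate_value_Ioo zero_le_one (continuous_binomialTail n m).continuousOn
  rw [binomialTail_zero hm, binomialTail_one hmn] at hivt
  obtain ⟨q, hq, hqa⟩ := hivt ha
  have hset : {x : ℝ | x ∈ Ioo (0 : ℝ) 1 ∧ regBeta x m ((n : ℝ) - m + 1) = a} = {q} := by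
    ext x
    simp only [regBeta_eq_binomialTail hm hmn, mem_ofPred_eq, mem_singleton_iff]
    refine ⟨fun hx => ?_, fun hx => hx ▸ ⟨hq, hqa⟩⟩
    exact (strictMonoOn_binomialTail hm hmn).injOn (Ioo_subset_Icc_self hx.1)
      (Ioo_subset_Icc_self hq) (hx.2.trans hqa.symm)
  rw [betaQuantile, hset, csInf_singleton]
  exact ⟨hq, hqa⟩

theorem lt_betaQuantile_iff {n m : ℕ} (hm : 1 ≤ m) (hmn : m ≤ n) {a p : ℝ}
    (ha : a ∈ Ioo (0 : ℝ) 1) (hp : p ∈ Ioo (0 : ℝ) 1) :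
    p < betaQuantile a m ((n : ℝ) - m + 1) ↔ binomialTail n m p < a := by
  obtain ⟨hq, hqa⟩ := betaQuantile_spec_s15 hm hmn ha
  rw [← (strictMonoOn_binomialTail hm hmn).lt_iff_lt (Ioo_subset_Icc_self hp)
    (Ioo_subset_Icc_self hq), hqa]

theorem betaQuantile_lt_iff {n m : ℕ} (hm : 1 ≤ m) (hmn : m ≤ n) {a p : ℝ}
    (ha : a ∈ Ioo (0 : ℝ) 1) (hp : p ∈ Ioo (0 : ℝ) 1) :
    betaQuantile a m ((n : ℝ) - m + 1) < p ↔ a < binomialTail n m p := by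
  obtain ⟨hq, hqa⟩ := betaQuantile_spec_s15 hm hmn ha
  rw [← (strictMonoOn_binomialTail hm hmn).lt_iff_lt (Ioo_subset_Icc_self hq)
    (Ioo_subset_Icc_self hp), hqa]

/-- A sum of nonnegative weights over indices whose upper tail sums are at most `c`. -/
theorem sum_le_of_forall_upper_tail_le {w : ℕ → ℝ} (hw : ∀ k, 0 ≤ w k) {N : ℕ} {c : ℝ}
    (hc : 0 ≤ c) (s : Finset ℕ) (hs : s ⊆ Finset.range N)
    (h : ∀ m ∈ s, ∑ k ∈ Finset.Ico m N, w k ≤ c) : ∑ k ∈ s, w k ≤ c := by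
  rcases s.eq_empty_or_nonempty with rfl | hne
  · simpa using hc
  · refine (Finset.sum_le_sum_of_subset_of_nonneg (fun k hk => ?_) fun k _ _ => hw k).trans
      (h _ (s.min'_mem hne))
    exact Finset.mem_Ico.mpr ⟨s.min'_le k hk, Finset.mem_range.mp (hs hk)⟩

/-- A sum of nonnegative weights over indices whose lower tail sums are at most `c`. -/
theorem sum_le_of_forall_lower_tail_le {w : ℕ → ℝ} (hw : ∀ k, 0 ≤ w k) {c : ℝ}
    (hc : 0 ≤ c) (s : Finset ℕ)
    (h : ∀ m ∈ s, ∑ k ∈ Finset.range (m + 1), w k ≤ c) : ∑ k ∈ s, w k ≤ c := by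
  rcases s.eq_empty_or_nonempty with rfl | hne
  · simpa using hc
  · refine (Finset.sum_le_sum_of_subset_of_nonneg (fun k hk => ?_) fun k _ _ => hw k).trans
      (h _ (s.max'_mem hne))
    exact Finset.mem_range.mpr (Nat.lt_succ_of_le (s.le_max' k hk))

/-- Coverage guarantee of the two-sided Clopper–Pearson confidence interval. -/
theorem clopperPearson_two_sided_coverage
    (n : ℕ) (hn : 1 ≤ n) (p α : ℝ) (hp : p ∈ Set.Ioo (0:ℝ) 1)
    (hα : α ∈ Set.Ioo (0:ℝ) 1)
    (L U : ℕ → ℝ)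
    (hL0 : L 0 = 0)
    (hL : ∀ m : ℕ, 1 ≤ m → m ≤ n →
      L m = betaQuantile (α / 2) (m : ℝ) ((n : ℝ) - (m : ℝ) + 1))
    (hUn : U n = 1)
    (hU : ∀ m : ℕ, m ≤ n - 1 →
      U m = betaQuantile (1 - α / 2) ((m : ℝ) + 1) ((n : ℝ) - (m : ℝ))) :
    1 - α ≤
      ∑ m ∈ (Finset.range (n + 1)).filter (fun m => L m ≤ p ∧ p ≤ U m),
        (n.choose m : ℝ) * p ^ m * (1 - p) ^ (n - m) := by
  obtain ⟨hp0, hp1⟩ := hp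
  obtain ⟨hα0, hα1⟩ := hα
  set w : ℕ → ℝ := fun m => (n.choose m : ℝ) * p ^ m * (1 - p) ^ (n - m) with hw_def
  have hw (k : ℕ) : 0 ≤ w k := by
    have : 0 ≤ 1 - p := by linarith
    positivity
  have hA : ∑ m ∈ (Finset.range (n + 1)).filter (fun m => p < L m), w m ≤ α / 2 := by
    refine sum_le_of_forall_upper_tail_le hw (N := n + 1) (by linarith) _
      (Finset.filter_subset _ _) fun m hm => ?_
    obtain ⟨hmn, hlt⟩ := Finset.mem_filter.mp hm
    have hmn : m ≤ n := Nat.lt_succ_iff.mp (Finset.mem_range.mp hmn)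
    have hm1 : 1 ≤ m := by
      rcases Nat.eq_zero_or_pos m with rfl | h
      · linarith
      · exact h
    rw [hL m hm1 hmn, lt_betaQuantile_iff hm1 hmn ⟨by linarith, by linarith⟩ ⟨hp0, hp1⟩] at hlt
    exact hlt.le
  have hB : ∑ m ∈ (Finset.range (n + 1)).filter (fun m => U m < p), w m ≤ α / 2 := by
    refine sum_le_of_forall_lower_tail_le hw (by linarith) _ fun m hm => ?_
    obtain ⟨hmn, hlt⟩ := Finset.mem_filter.mp hm
    have hmn : m < n := by
      rcases (Nat.lt_succ_iff.mp (Finset.mem_range.mp hmn)).eq_or_lt with rfl | h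
      · linarith
      · exact h
    have hparam : (n : ℝ) - m = n - ((m + 1 : ℕ) : ℝ) + 1 := by push_cast; ring
    rw [hU m (by omega), hparam, ← Nat.cast_succ,
      betaQuantile_lt_iff (by omega) hmn ⟨by linarith, by linarith⟩ ⟨hp0, hp1⟩] at hlt
    have := sum_range_add_binomialTail (n := n) (m := m + 1) (by omega) p
    linarith
  have hcover : ∑ m ∈ Finset.range (n + 1), w m ≤
      ∑ m ∈ (Finset.range (n + 1)).filter (fun m => L m ≤ p ∧ p ≤ U m), w m +
      (∑ m ∈ (Finset.range (n + 1)).filter (fun m => p < L m), w m +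
      ∑ m ∈ (Finset.range (n + 1)).filter (fun m => U m < p), w m) := by
    simp only [Finset.sum_filter, ← Finset.sum_add_distrib]
    refine Finset.sum_le_sum fun m _ => ?_
    have := hw m
    split_ifs <;> grind
  have htotal : ∑ m ∈ Finset.range (n + 1), w m = 1 := sum_range_binomial n p
  linarith
end
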